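/- Let φ, ρ : ℝ⁴ → ℝ be smooth and let Γ^a_{bc}(x) = t_b t_c ∂^aφ(x) be the Christoffel symbols of the geometrized Newtonian connection associated with φ. Then its Ricci tensor satisfies R_{bd}(x) = (Σ_{i=1}^{3} ∂_i ∂_i φ(x)) · t_b t_d for all x and all b,d. Consequently, φ satisfies Poisson's equation Σ_{i=1}^{3} ∂_i ∂_i φ = 4πρ on ℝ⁴ if and only if the geometrized Poisson equation R_{bd} = 4πρ t_b t_d holds at every point (curvature condition CC1 of the Trautman Geometrization Lemma). -/

import Mathlib

/-- Partial derivative in the `a`-th coordinate direction on `ℝ⁴`. -/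
noncomputable def pd (a : Fin 4) (f : (Fin 4 → ℝ) → ℝ) (x : Fin 4 → ℝ) : ℝ :=
  fderiv ℝ f x (Pi.single a 1)

/-- The temporal covector `t_a`: `t_0 = 1`, `t_1 = t_2 = t_3 = 0`. -/
def tcov (a : Fin 4) : ℝ := if a = 0 then 1 else 0

/-- The spatial metric `h^{ab} = diag(0,1,1,1)`. -/
def hmat (a b : Fin 4) : ℝ := if a = b ∧ a ≠ 0 then 1 else 0

/-- The raised spatial gradient `∂^a φ = Σ_b h^{ab} ∂_b φ`. -/
noncomputable def gradUp (φ : (Fin 4 → ℝ) → ℝ) (a : Fin 4) (x : Fin 4 → ℝ) : ℝ :=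
  ∑ b, hmat a b * pd b φ x

/-- Christoffel symbols `Γ^a_{bc} = t_b t_c ∂^a φ` of the geometrized Newtonian connection. -/
noncomputable def chris (φ : (Fin 4 → ℝ) → ℝ) (a b c : Fin 4) (x : Fin 4 → ℝ) : ℝ :=
  tcov b * tcov c * gradUp φ a x

/-- Riemann curvature tensor
`R^a_{bcd} = ∂_c Γ^a_{db} − ∂_d Γ^a_{cb} + Σ_e (Γ^a_{ce} Γ^e_{db} − Γ^a_{de} Γ^e_{cb})`. -/
noncomputable def riem (φ : (Fin 4 → ℝ) → ℝ) (a b c d : Fin 4) (x : Fin 4 → ℝ) : ℝ :=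
  pd c (chris φ a d b) x - pd d (chris φ a c b) x
    + ∑ e, (chris φ a c e x * chris φ e d b x - chris φ a d e x * chris φ e c b x)

/-- Ricci tensor `R_{bd} = Σ_a R^a_{bad}` of the geometrized Newtonian connection. -/
noncomputable def ricci (φ : (Fin 4 → ℝ) → ℝ) (b d : Fin 4) (x : Fin 4 → ℝ) : ℝ :=
  ∑ a, riem φ a b a d x

theorem gradUp_zero (φ : (Fin 4 → ℝ) → ℝ) (x : Fin 4 → ℝ) : gradUp φ 0 x = 0 := by
  simp [gradUp, hmat]

theorem gradUp_of_ne_zero (φ : (Fin 4 → ℝ) → ℝ) {a : Fin 4} (ha : a ≠ 0) :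
    gradUp φ a = pd a φ := by
  funext x
  simp [gradUp, hmat, ha]

/-- The raised gradient is spatial: `t_a ∂^a φ = 0`, without summation. -/
theorem tcov_mul_gradUp (φ : (Fin 4 → ℝ) → ℝ) (a : Fin 4) (x : Fin 4 → ℝ) :
    tcov a * gradUp φ a x = 0 := by
  by_cases ha : a = 0
  · rw [ha, gradUp_zero, mul_zero]
  · simp [tcov, ha]

theorem chris_self_left (φ : (Fin 4 → ℝ) → ℝ) (a b : Fin 4) : chris φ a a b = fun _ => 0 := by
  funext x
  linear_combination (norm := (unfold chris; ring)) tcov b * tcov_mul_gradUp φ a x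

theorem chris_mul_chris (φ : (Fin 4 → ℝ) → ℝ) (a b c d e : Fin 4) (x : Fin 4 → ℝ) :
    chris φ a d e x * chris φ e c b x = 0 := by
  linear_combination (norm := (unfold chris; ring))
    tcov d * gradUp φ a x * tcov c * tcov b * tcov_mul_gradUp φ e x

theorem pd_const (a : Fin 4) (c : ℝ) (x : Fin 4 → ℝ) : pd a (fun _ => c) x = 0 := by
  simp [pd]

theorem pd_const_mul (a : Fin 4) (c : ℝ) (f : (Fin 4 → ℝ) → ℝ) (x : Fin 4 → ℝ) :
    pd a (fun y => c * f y) x = c * pd a f x := by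
  have h : fderiv ℝ (fun y => c * f y) x = c • fderiv ℝ f x :=
    congrFun (fderiv_const_smul_field (f := f) c) x
  simp [pd, h]

theorem riem_self (φ : (Fin 4 → ℝ) → ℝ) (a b d : Fin 4) (x : Fin 4 → ℝ) :
    riem φ a b a d x = tcov d * tcov b * pd a (gradUp φ a) x := by
  have h : pd a (chris φ a d b) x = tcov d * tcov b * pd a (gradUp φ a) x :=
    pd_const_mul a (tcov d * tcov b) (gradUp φ a) x
  simp [riem, chris_mul_chris, chris_self_left, pd_const, h]

theorem ricci_eq (φ : (Fin 4 → ℝ) → ℝ) (x : Fin 4 → ℝ) (b d : Fin 4) :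
    ricci φ b d x =
      (∑ i ∈ ({1, 2, 3} : Finset (Fin 4)), pd i (pd i φ) x) * tcov b * tcov d := by
  have h₀ : gradUp φ 0 = fun _ => 0 := funext (gradUp_zero φ)
  have h₁ : gradUp φ 1 = pd 1 φ := gradUp_of_ne_zero φ (by decide)
  have h₂ : gradUp φ 2 = pd 2 φ := gradUp_of_ne_zero φ (by decide)
  have h₃ : gradUp φ 3 = pd 3 φ := gradUp_of_ne_zero φ (by decide)
  have hs : ∑ i ∈ ({1, 2, 3} : Finset (Fin 4)), pd i (pd i φ) x =
      pd 1 (pd 1 φ) x + pd 2 (pd 2 φ) x + pd 3 (pd 3 φ) x := by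
    rw [Finset.sum_insert (by decide), Finset.sum_insert (by decide), Finset.sum_singleton,
      add_assoc]
  simp only [ricci, riem_self, Fin.sum_univ_four, h₀, h₁, h₂, h₃, hs, pd_const]
  ring


/-- For the geometrized Newtonian connection, `R_{bd} = (Σ_{i=1}^{3} ∂_i ∂_i φ) t_b t_d`;
consequently Poisson's equation `Σ_i ∂_i ∂_i φ = 4πρ` holds on `ℝ⁴` iff the geometrized
Poisson equation `R_{bd} = 4πρ t_b t_d` holds at every point (curvature condition CC1). -/
theorem stmt_5 (φ ρ : (Fin 4 → ℝ) → ℝ) (hφ : ContDiff ℝ (⊤ : ℕ∞) φ) (hρ : ContDiff ℝ (⊤ : ℕ∞) ρ) :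
    (∀ (x : Fin 4 → ℝ) (b d : Fin 4),
      ricci φ b d x = (∑ i ∈ ({1, 2, 3} : Finset (Fin 4)), pd i (pd i φ) x) * tcov b * tcov d) ∧
    ((∀ x : Fin 4 → ℝ,
        ∑ i ∈ ({1, 2, 3} : Finset (Fin 4)), pd i (pd i φ) x = 4 * Real.pi * ρ x) ↔
      (∀ (x : Fin 4 → ℝ) (b d : Fin 4),
        ricci φ b d x = 4 * Real.pi * ρ x * (tcov b * tcov d))) := by
  refine ⟨ricci_eq φ, fun h x b d => ?_, fun h x => ?_⟩
  · rw [ricci_eq, h, mul_assoc]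
  · simpa [ricci_eq, tcov] using h x 0 0
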